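/- Let K be a field and ω a polynomial r-form on K^n. If there exist pairwise non-associate irreducible polynomials F_1,…,F_m ∈ K[z] invariant by ω and integer constants δ_1,…,δ_m (elements of the prime subfield Z_p of K if char K = p > 0), not all zero, such that δ_1Θ_{F_1}+…+δ_mΘ_{F_m} = dω, then ω has a rational integration factor; more precisely, after possibly replacing each δ_i by −δ_i, the rational function f = F_1^{δ_1}⋯F_m^{δ_m} satisfies d(fω) = 0. -/

import Mathlib

/- Framework: rational function field `K(z) = K(z₁,…,zₙ)`, its subfield `K(zᵖ)` of
∂-constants, and rational differential forms modelled as the exterior algebra over `K(z)`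
on the free module with basis `dz₁,…,dzₙ` (canonically isomorphic to the exterior powers
of the Kähler differentials `Ω¹_{K(z)/K}`); the wedge product is the algebra product. -/

set_option synthInstance.maxHeartbeats 1000000
set_option maxHeartbeats 4000000

noncomputable section
open MvPolynomial

/-- The field of rational functions `K(z₁,…,zₙ)`. -/
abbrev Kz (K : Type) [Field K] (n : ℕ) := FractionRing (MvPolynomial (Fin n) K)

variable (K : Type) [Field K] (n : ℕ)

/-- The inclusion of polynomials into rational functions. -/
def toKz : MvPolynomial (Fin n) K →+* Kz K n := algebraMap _ _

/-- Rational differential forms on `Kⁿ`. -/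
abbrev Forms (K : Type) [Field K] (n : ℕ) := ExteriorAlgebra (Kz K n) (Fin n → Kz K n)

/-- The 1-form `dz i`. -/
def dz (i : Fin n) : Forms K n := ExteriorAlgebra.ι (Kz K n) (Pi.single i 1)

/-- The 1-form with coordinates `v` with respect to the basis `dz₁,…,dzₙ`. -/
def oneForm (v : Fin n → Kz K n) : Forms K n := ExteriorAlgebra.ι (Kz K n) v

/-- The `r`-form `dz_{s 0} ∧ ⋯ ∧ dz_{s (r-1)}`. -/
def dzP (r : ℕ) (s : Fin r → Fin n) : Forms K n := (List.ofFn fun i => dz K n (s i)).prod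

/-- The partial derivative `∂/∂zᵢ`, extended from `K[z]` to `K(z)` by the quotient rule
(applied to a chosen fraction representation; the value does not depend on the choice). -/
def pd (i : Fin n) (f : Kz K n) : Kz K n :=
  let a := (IsLocalization.sec (nonZeroDivisors (MvPolynomial (Fin n) K)) f).1
  let b := ((IsLocalization.sec (nonZeroDivisors (MvPolynomial (Fin n) K)) f).2 :
      MvPolynomial (Fin n) K)
  (toKz K n (pderiv i a) * toKz K n b - toKz K n a * toKz K n (pderiv i b)) / (toKz K n b) ^ 2

/-- The differential `df = ∑ᵢ (∂f/∂zᵢ) dzᵢ` of a rational function `f`. -/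
def dd (f : Kz K n) : Forms K n := ∑ i, pd K n i f • dz K n i

/-- The `r`-form with (rational) coefficients `c`. -/
def formOf (r : ℕ) (c : (Fin r → Fin n) → Kz K n) : Forms K n := ∑ s, c s • dzP K n r s

/-- The exterior derivative of the `r`-form with coefficients `c`:
`d(∑ c_s dz_s) = ∑ (d c_s) ∧ dz_s`. -/
def Dform (r : ℕ) (c : (Fin r → Fin n) → Kz K n) : Forms K n := ∑ s, dd K n (c s) * dzP K n r s

/-- The polynomial `r`-form with polynomial coefficients `c`. -/
def polyFormOf (r : ℕ) (c : (Fin r → Fin n) → MvPolynomial (Fin n) K) : Forms K n :=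
  formOf K n r fun s => toKz K n (c s)

/-- The exterior derivative of the polynomial `r`-form with coefficients `c`. -/
def Dpoly (r : ℕ) (c : (Fin r → Fin n) → MvPolynomial (Fin n) K) : Forms K n :=
  Dform K n r fun s => toKz K n (c s)

/-- The exterior derivative of the 1-form with coordinates `v`. -/
def d1 (v : Fin n → Kz K n) : Forms K n := ∑ j, dd K n (v j) * dz K n j

/-- The subfield `K(zᵖ) = K(z₁ᵖ,…,zₙᵖ) ⊆ K(z)` of ∂-constants. -/
def pConsts (p : ℕ) : Subfield (Kz K n) :=
  Subfield.closure (Set.range (algebraMap K (Kz K n)) ∪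
    Set.range fun i : Fin n => (toKz K n (X i)) ^ p)

/-- `F` is invariant by the `r`-form `ω`: `dF ≠ 0` and `F` divides `ω ∧ dF`,
the quotient being a polynomial `(r+1)`-form (the cofactor `Θ_F`). -/
def FormInvariant (r : ℕ) (ω : Forms K n) (F : MvPolynomial (Fin n) K) : Prop :=
  dd K n (toKz K n F) ≠ 0 ∧
    ∃ Θ : (Fin (r + 1) → Fin n) → MvPolynomial (Fin n) K,
      ω * dd K n (toKz K n F) = toKz K n F • polyFormOf K n (r + 1) Θ

/-- `f` is a rational first integral of the form `ω`: `df ≠ 0` and `ω ∧ df = 0`. -/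
def IsFirstIntegral (ω : Forms K n) (f : Kz K n) : Prop :=
  dd K n f ≠ 0 ∧ ω * dd K n f = 0

/-- The `K(zᵖ)`-subspace `Ω^r_{L_d/K(zᵖ)}` spanned by the forms
`z^I · dz_{s 0} ∧ ⋯ ∧ dz_{s (r-1)}` with `0 ≤ I j ≤ p−1` and `∑ I ≤ d`. -/
def Lforms (p d r : ℕ) : Submodule (pConsts K n p) (Forms K n) :=
  Submodule.span (pConsts K n p)
    { x | ∃ (I : Fin n → ℕ) (s : Fin r → Fin n), (∀ j, I j ≤ p - 1) ∧ (∑ j, I j ≤ d) ∧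
        x = toKz K n (∏ j, X j ^ I j) • dzP K n r s }

/-- `N_K(n,d,r) = dim_{K(zᵖ)} Ω^r_{L_d/K(zᵖ)}`. -/
def NK (p d r : ℕ) : ℕ := Module.finrank (pConsts K n p) (Lforms K n p d r)

/-- The submodule of `r`-forms (the `r`-th exterior power of the module of 1-forms). -/
def gradeR (r : ℕ) : Submodule (Kz K n) (Forms K n) :=
  (LinearMap.range (ExteriorAlgebra.ι (Kz K n) :
      (Fin n → Kz K n) →ₗ[Kz K n] Forms K n)) ^ r

variable {K n} in
/-- The quotient rule for `pd`, for an arbitrary fraction representation. -/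
lemma pd_div (i : Fin n) (a b : MvPolynomial (Fin n) K) (hb : toKz K n b ≠ 0) :
    pd K n i (toKz K n a / toKz K n b) =
      (toKz K n (pderiv i a) * toKz K n b - toKz K n a * toKz K n (pderiv i b)) /
        (toKz K n b) ^ 2 := by
  have hinj : Function.Injective (toKz K n) :=
    IsFractionRing.injective (MvPolynomial (Fin n) K) (Kz K n)
  have hsec := IsLocalization.sec_spec (nonZeroDivisors (MvPolynomial (Fin n) K))
    (toKz K n a / toKz K n b)
  unfold pd
  generalize IsLocalization.sec (nonZeroDivisors (MvPolynomial (Fin n) K))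
    (toKz K n a / toKz K n b) = q at hsec ⊢
  obtain ⟨x, y, hy⟩ := q
  change toKz K n a / toKz K n b * toKz K n y = toKz K n x at hsec
  dsimp only
  have hy0 : toKz K n y ≠ 0 := by
    simpa using (map_ne_zero_iff _ hinj).2 (nonZeroDivisors.ne_zero hy)
  have h : toKz K n a * toKz K n y = toKz K n x * toKz K n b := by
    rw [← hsec]; field_simp
  have hp : a * y = x * b := hinj (by simpa using h)
  have hd := congrArg (fun t => toKz K n (pderiv i t)) hp
  simp only [Derivation.leibniz, smul_eq_mul, map_add, map_mul] at hd
  rw [div_eq_div_iff (pow_ne_zero 2 hy0) (pow_ne_zero 2 hb)]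
  linear_combination (-toKz K n b * toKz K n y) * hd +
    (toKz K n (pderiv i b) * toKz K n y + toKz K n b * toKz K n (pderiv i y)) * h

variable {K n} in
lemma exists_eq_toKz_div (f : Kz K n) :
    ∃ a b : MvPolynomial (Fin n) K, toKz K n b ≠ 0 ∧ f = toKz K n a / toKz K n b := by
  have hinj : Function.Injective (toKz K n) :=
    IsFractionRing.injective (MvPolynomial (Fin n) K) (Kz K n)
  obtain ⟨a, b, hb, h⟩ := IsFractionRing.div_surjective (A := MvPolynomial (Fin n) K) f
  exact ⟨a, b, (map_ne_zero_iff _ hinj).2 (nonZeroDivisors.ne_zero hb), h.symm⟩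

variable {K n} in
lemma pd_mul (i : Fin n) (f g : Kz K n) :
    pd K n i (f * g) = f * pd K n i g + g * pd K n i f := by
  obtain ⟨a, b, hb, rfl⟩ := exists_eq_toKz_div f
  obtain ⟨a', b', hb', rfl⟩ := exists_eq_toKz_div g
  have hbb : toKz K n (b * b') ≠ 0 := by
    rw [map_mul]; exact mul_ne_zero hb hb'
  rw [div_mul_div_comm, ← map_mul, ← map_mul, pd_div i _ _ hbb, pd_div i _ _ hb,
    pd_div i _ _ hb']
  simp only [Derivation.leibniz, smul_eq_mul, map_add, map_mul]
  field_simp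
  ring

/-- The logarithmic derivative `f ↦ (∂f/∂zᵢ) / f`, as a homomorphism from the multiplicative
group of `K(z)` to its additive group. -/
def logPd (i : Fin n) : (Kz K n)ˣ →* Multiplicative (Kz K n) :=
  MonoidHom.mk' (fun u => Multiplicative.ofAdd (pd K n i (u : Kz K n) / u)) fun u v => by
    rw [← ofAdd_add, Units.val_mul, pd_mul]
    congr 1
    have hu := u.ne_zero
    have hv := v.ne_zero
    field_simp
    ring

variable {K n} in
lemma pd_prod_zpow (i : Fin n) {m : ℕ} (F : Fin m → Kz K n) (hF : ∀ j, F j ≠ 0)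
    (e : Fin m → ℤ) :
    pd K n i (∏ j, F j ^ e j) = (∏ j, F j ^ e j) * ∑ j, (e j : Kz K n) * (pd K n i (F j) / F j) := by
  have h : logPd K n i (∏ j, Units.mk0 (F j) (hF j) ^ e j) =
      ∏ j, logPd K n i (Units.mk0 (F j) (hF j)) ^ e j := by
    simp only [map_prod, map_zpow]
  have h' := congrArg Multiplicative.toAdd h
  rw [toAdd_prod] at h'
  simp only [toAdd_zpow, zsmul_eq_mul] at h'
  have hu : ((∏ j, Units.mk0 (F j) (hF j) ^ e j : (Kz K n)ˣ) : Kz K n) = ∏ j, F j ^ e j := by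
    simp [Units.coe_prod]
  change pd K n i ((∏ j, Units.mk0 (F j) (hF j) ^ e j : (Kz K n)ˣ) : Kz K n) /
    ((∏ j, Units.mk0 (F j) (hF j) ^ e j : (Kz K n)ˣ) : Kz K n) =
      ∑ j, (e j : Kz K n) * (pd K n i (F j) / F j) at h'
  rw [hu] at h'
  rw [← h', mul_div_cancel₀]
  exact Finset.prod_ne_zero_iff.2 fun j _ => zpow_ne_zero _ (hF j)

variable {K n} in
lemma dd_mul (f g : Kz K n) : dd K n (f * g) = f • dd K n g + g • dd K n f := by
  simp only [dd, pd_mul, add_smul, mul_smul, Finset.sum_add_distrib, Finset.smul_sum]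

variable {K n} in
lemma dd_prod_zpow {m : ℕ} (F : Fin m → Kz K n) (hF : ∀ j, F j ≠ 0) (e : Fin m → ℤ) :
    dd K n (∏ j, F j ^ e j) =
      (∏ j, F j ^ e j) • ∑ j, ((e j : Kz K n) * (F j)⁻¹) • dd K n (F j) := by
  simp only [dd, pd_prod_zpow _ F hF, Finset.smul_sum, Finset.mul_sum, Finset.sum_smul]
  rw [Finset.sum_comm]
  refine Finset.sum_congr rfl fun j _ => Finset.sum_congr rfl fun i _ => ?_
  rw [smul_smul, smul_smul]
  congr 1
  ring

variable {K n} in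
lemma dd_eq_ι (f : Kz K n) :
    dd K n f = ExteriorAlgebra.ι (Kz K n) (∑ i, pd K n i f • Pi.single i (1 : Kz K n)) := by
  simp only [dd, dz, map_sum, map_smul]

lemma ι_mul_dzP (v : Fin n → Kz K n) (r : ℕ) (s : Fin r → Fin n) :
    ExteriorAlgebra.ι (Kz K n) v * dzP K n r s =
      (-1 : Kz K n) ^ r • (dzP K n r s * ExteriorAlgebra.ι (Kz K n) v) := by
  induction r with
  | zero => simp [dzP]
  | succ r ih =>
    have hs : dzP K n (r + 1) s = dz K n (s 0) * dzP K n r (fun i => s i.succ) := by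
      simp [dzP, List.ofFn_succ]
    have hanti : ExteriorAlgebra.ι (Kz K n) v * dz K n (s 0) =
        -(dz K n (s 0) * ExteriorAlgebra.ι (Kz K n) v) :=
      eq_neg_of_add_eq_zero_left (ExteriorAlgebra.ι_add_mul_swap _ _)
    rw [hs, ← mul_assoc, hanti, neg_mul, mul_assoc, ih, mul_smul_comm, mul_assoc, pow_succ,
      mul_neg_one, neg_smul]

variable {K n} in
lemma dd_mul_formOf (f : Kz K n) (r : ℕ) (c : (Fin r → Fin n) → Kz K n) :
    dd K n f * formOf K n r c = (-1 : Kz K n) ^ r • (formOf K n r c * dd K n f) := by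
  rw [dd_eq_ι]
  simp only [formOf, Finset.mul_sum, Finset.sum_mul, Finset.smul_sum]
  refine Finset.sum_congr rfl fun s _ => ?_
  rw [mul_smul_comm, ι_mul_dzP, smul_mul_assoc, smul_comm]

variable {K n} in
/-- The Leibniz rule `d(fω) = f dω + df ∧ ω`. -/
lemma Dform_mul (f : Kz K n) (r : ℕ) (c : (Fin r → Fin n) → Kz K n) :
    Dform K n r (fun s => f * c s) = f • Dform K n r c + dd K n f * formOf K n r c := by
  simp only [Dform, formOf, Finset.mul_sum, Finset.smul_sum, ← Finset.sum_add_distrib]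
  refine Finset.sum_congr rfl fun s _ => ?_
  rw [dd_mul, add_mul, smul_mul_assoc, smul_mul_assoc, mul_smul_comm]

/-- If the polynomial `r`-form `ω` has pairwise non-associate invariant irreducible
polynomials `F₁,…,F_m` with cofactors `Θ_{F₁},…,Θ_{F_m}` and there are integers
`δ₁,…,δ_m` (viewed in the prime subfield of `K`), not all zero, with
`δ₁Θ_{F₁} + ⋯ + δ_mΘ_{F_m} = dω`, then, after possibly replacing each `δᵢ` by `−δᵢ`
(i.e. for some sign `σ = ±1`), the rational function `f = ∏ᵢ Fᵢ^{σδᵢ}` is an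
integration factor of `ω`: `d(fω) = 0`. -/
theorem statement17 (r m : ℕ)
    (c : (Fin r → Fin n) → MvPolynomial (Fin n) K)
    (F : Fin m → MvPolynomial (Fin n) K)
    (hirr : ∀ i, Irreducible (F i))
    (hna : ∀ i j, i ≠ j → ¬ Associated (F i) (F j))
    (hdF : ∀ i, dd K n (toKz K n (F i)) ≠ 0)
    (Θ : Fin m → ((Fin (r + 1) → Fin n) → MvPolynomial (Fin n) K))
    (hcof : ∀ i, polyFormOf K n r c * dd K n (toKz K n (F i)) =
        toKz K n (F i) • polyFormOf K n (r + 1) (Θ i))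
    (δ : Fin m → ℤ) (hδ : ∃ i, (δ i : K) ≠ 0)
    (hrel : ∑ i, δ i • polyFormOf K n (r + 1) (Θ i) = Dpoly K n r c) :
    ∃ σ : ℤ, (σ = 1 ∨ σ = -1) ∧
      Dform K n r
        (fun s => (∏ i, toKz K n (F i) ^ (σ * δ i)) * toKz K n (c s)) = 0 := by
  have hinj : Function.Injective (toKz K n) :=
    IsFractionRing.injective (MvPolynomial (Fin n) K) (Kz K n)
  have hF : ∀ i, toKz K n (F i) ≠ 0 := fun i => (map_ne_zero_iff _ hinj).2 (hirr i).ne_zero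
  have hsign : (-1 : ℤ) ^ r = 1 ∨ (-1 : ℤ) ^ r = -1 := neg_one_pow_eq_or ℤ r
  refine ⟨-(-1) ^ r, by rcases hsign with h | h <;> simp [h], ?_⟩
  rw [Dform_mul, dd_mul_formOf, dd_prod_zpow _ hF]
  have key : polyFormOf K n r c * ∑ j, (((-(-1) ^ r * δ j : ℤ) : Kz K n) * (toKz K n (F j))⁻¹) •
      dd K n (toKz K n (F j)) = (-(-1 : Kz K n) ^ r) • Dpoly K n r c := by
    rw [← hrel, Finset.mul_sum, Finset.smul_sum]
    refine Finset.sum_congr rfl fun j _ => ?_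
    rw [mul_smul_comm, hcof, smul_smul, inv_mul_cancel_right₀ (hF j),
      ← Int.cast_smul_eq_zsmul (Kz K n), smul_smul]
    push_cast
    rfl
  change _ • Dpoly K n r c + (-1 : Kz K n) ^ r • (polyFormOf K n r c * _) = 0
  rw [mul_smul_comm, key, smul_comm ((-1 : Kz K n) ^ r), smul_smul ((-1 : Kz K n) ^ r),
    mul_neg, ← pow_add, ← two_mul, pow_mul, neg_one_sq, one_pow, neg_one_smul, smul_neg,
    add_neg_cancel]
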